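/- Let T > 0 and let f : [0,T] × ℝ³ × ℝ³ → [0,∞) be continuous, with t ↦ f(t,x,u) differentiable for each fixed (x,u), satisfying: ∂f/∂t(t,·,·) ∈ L¹(ℝ⁶) for each t (Hypothesis B1); s ↦ sup_{x∈ℝ³} ∫_{ℝ³} ‖z‖^{1+γ} f(s,x,z) dz is continuous on [0,T] (Hypothesis B2); and t ↦ sup_{x∈ℝ³} ∫_{ℝ³} ‖z‖^{1+γ} |∂f/∂t(t,x,z)| dz belongs to L¹([0,T]) (Hypothesis B3). Then for each ψ ∈ C²_c(ℝ⁶), the function g(s) := ∫_{ℝ⁶} ∫_{ℝ³} ∫_(0,π] ∫_[0,2π) [ ψ(x, u + α(u,v,θ,φ)) − ψ(x,u) ] σ(‖u−v‖) f(s,x,v) f(s,x,u) dφ Q(dθ) dv dx du is continuous on [0,T]. -/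

import Mathlib

open MeasureTheory Real Set Filter

noncomputable section

/-- Three-dimensional Euclidean space. -/
abbrev E3 : Type := EuclideanSpace ℝ (Fin 3)

open Classical in
/-- `Γ(X, φ) = cos φ · I(X) + sin φ · J(X)` (with `Γ(0, φ) := 0`). -/
def Gam (I J : E3 → E3) (X : E3) (φ : ℝ) : E3 :=
  if X = 0 then 0 else Real.cos φ • I X + Real.sin φ • J X

/-- The collision deflection `α(z,v,θ,φ) = sin²(θ/2)·(v−z) + (sin θ/2)·Γ(v−z, φ)`. -/
def alpha (I J : E3 → E3) (z v : E3) (θ φ : ℝ) : E3 :=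
  Real.sin (θ / 2) ^ 2 • (v - z) + (Real.sin θ / 2) • Gam I J (v - z) φ

lemma norm_Gam_le {I J : E3 → E3}
    (hON : ∀ X : E3, X ≠ 0 → Orthonormal ℝ ![‖X‖⁻¹ • X, ‖X‖⁻¹ • I X, ‖X‖⁻¹ • J X])
    (X : E3) (φ : ℝ) : ‖Gam I J X φ‖ ≤ 2 * ‖X‖ := by
  unfold Gam
  split_ifs with h
  · simp [h]
  · have hX : 0 < ‖X‖ := norm_pos_iff.2 h
    have h1 : ‖I X‖ = ‖X‖ := by
      have := (hON X h).1 1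
      simp only [Matrix.cons_val_one, Matrix.cons_val_zero, norm_smul, norm_inv, norm_norm] at this
      field_simp at this
      exact this
    have h2 : ‖J X‖ = ‖X‖ := by
      have := (hON X h).1 2
      simp only [Matrix.cons_val, norm_smul, norm_inv, norm_norm] at this
      field_simp at this
      exact this
    calc ‖Real.cos φ • I X + Real.sin φ • J X‖
        ≤ ‖Real.cos φ • I X‖ + ‖Real.sin φ • J X‖ := norm_add_le _ _
      _ = |Real.cos φ| * ‖X‖ + |Real.sin φ| * ‖X‖ := by
          simp only [norm_smul, Real.norm_eq_abs, h1, h2]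
      _ ≤ 1 * ‖X‖ + 1 * ‖X‖ := by
          gcongr
          · exact Real.abs_cos_le_one φ
          · exact Real.abs_sin_le_one φ
      _ = 2 * ‖X‖ := by ring

lemma norm_alpha_le {I J : E3 → E3}
    (hON : ∀ X : E3, X ≠ 0 → Orthonormal ℝ ![‖X‖⁻¹ • X, ‖X‖⁻¹ • I X, ‖X‖⁻¹ • J X])
    (u v : E3) {θ : ℝ} (hθ : 0 ≤ θ) (φ : ℝ) :
    ‖alpha I J u v θ φ‖ ≤ 2 * θ * ‖u - v‖ := by
  have h1 : |Real.sin (θ / 2) ^ 2| ≤ θ / 2 := by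
    have ha : |Real.sin (θ / 2)| ≤ θ / 2 := by
      simpa only [abs_of_nonneg (div_nonneg hθ zero_le_two)] using Real.abs_sin_le_abs (x := θ / 2)
    have hb := Real.abs_sin_le_one (θ / 2)
    rw [abs_pow]
    nlinarith [abs_nonneg (Real.sin (θ / 2))]
  have h2 : |Real.sin θ / 2| ≤ θ / 2 := by
    have ha : |Real.sin θ| ≤ θ := by
      simpa [abs_of_nonneg hθ] using Real.abs_sin_le_abs (x := θ)
    rw [abs_div, abs_two]
    linarith
  have h3 := norm_Gam_le hON (v - u) φ
  calc ‖alpha I J u v θ φ‖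
      ≤ ‖Real.sin (θ / 2) ^ 2 • (v - u)‖ + ‖(Real.sin θ / 2) • Gam I J (v - u) φ‖ :=
        norm_add_le _ _
    _ = |Real.sin (θ / 2) ^ 2| * ‖v - u‖ + |Real.sin θ / 2| * ‖Gam I J (v - u) φ‖ := by
        simp only [norm_smul, Real.norm_eq_abs]
    _ ≤ θ / 2 * ‖v - u‖ + θ / 2 * (2 * ‖v - u‖) := by gcongr
    _ ≤ 2 * θ * ‖v - u‖ := by nlinarith [mul_nonneg hθ (norm_nonneg (v - u))]
    _ = 2 * θ * ‖u - v‖ := by rw [norm_sub_rev]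

lemma measurable_alpha {I J : E3 → E3} (hI : Measurable I) (hJ : Measurable J) :
    Measurable (fun q : (((E3 × E3) × E3) × ℝ) × ℝ =>
      alpha I J q.1.1.1.2 q.1.1.2 q.1.2 q.2) := by
  have hG : Measurable (fun q : E3 × ℝ => Gam I J q.1 q.2) := by
    unfold Gam
    refine Measurable.ite ?_ measurable_const (by fun_prop)
    exact measurable_fst (measurableSet_singleton 0)
  unfold alpha
  have h2 : Measurable (fun q : (((E3 × E3) × E3) × ℝ) × ℝ =>
      Gam I J (q.1.1.2 - q.1.1.1.2) q.2) :=
    hG.comp (g := fun q : E3 × ℝ => Gam I J q.1 q.2)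
      (f := fun q : (((E3 × E3) × E3) × ℝ) × ℝ => (q.1.1.2 - q.1.1.1.2, q.2)) (by fun_prop)
  fun_prop

/-- The collision kernel obtained by integrating out both deflection angles. -/
def collisionKernel (I J : E3 → E3) (Q : Measure ℝ) (c γ : ℝ) (ψ : E3 × E3 → ℝ)
    (q : (E3 × E3) × E3) : ℝ :=
  (∫ θ in Set.Ioc 0 π, ∫ φ in Set.Ico 0 (2 * π),
    (ψ (q.1.1, q.1.2 + alpha I J q.1.2 q.2 θ φ) - ψ q.1) ∂volume ∂Q) * (c * ‖q.1.2 - q.2‖ ^ γ)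

lemma measurable_collisionKernel {I J : E3 → E3} (hI : Measurable I) (hJ : Measurable J)
    (Q : Measure ℝ) [SigmaFinite Q] (c γ : ℝ) {ψ : E3 × E3 → ℝ} (hψ : Measurable ψ) :
    Measurable (collisionKernel I J Q c γ ψ) := by
  have hα := measurable_alpha hI hJ
  have hD : StronglyMeasurable (fun q : (((E3 × E3) × E3) × ℝ) × ℝ =>
      ψ (q.1.1.1.1, q.1.1.1.2 + alpha I J q.1.1.1.2 q.1.1.2 q.1.2 q.2) - ψ q.1.1.1) := by
    apply Measurable.stronglyMeasurable
    fun_prop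
  have h1 := hD.integral_prod_right' (ν := volume.restrict (Set.Ico 0 (2 * π)))
  have h2 := h1.integral_prod_right' (ν := Q.restrict (Set.Ioc 0 π))
  unfold collisionKernel
  refine h2.measurable.mul ?_
  fun_prop

lemma collisionKernel_eq_zero {I J : E3 → E3} {Q : Measure ℝ} {c γ : ℝ} {ψ : E3 × E3 → ℝ}
    {q : (E3 × E3) × E3} (hq : q.1.1 ∉ Prod.fst '' tsupport ψ) :
    collisionKernel I J Q c γ ψ q = 0 := by
  have h : ∀ u, ψ (q.1.1, u) = 0 := fun u =>
    image_eq_zero_of_notMem_tsupport fun hu => hq ⟨_, hu, rfl⟩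
  simp [collisionKernel, h]

/-- The kernel is dominated by `‖u - v‖ ^ (1 + γ)` with a coefficient that is bounded and vanishes
as `‖u - v‖ → ∞`. -/
lemma exists_collisionKernel_bound {I J : E3 → E3}
    (hON : ∀ X : E3, X ≠ 0 → Orthonormal ℝ ![‖X‖⁻¹ • X, ‖X‖⁻¹ • I X, ‖X‖⁻¹ • J X])
    {Q : Measure ℝ} (hQ : ∫⁻ θ in Set.Ioc 0 π, ENNReal.ofReal θ ∂Q ≠ ⊤)
    {c γ : ℝ} (hc : 0 < c) (hγ : 0 < 1 + γ) {ψ : E3 × E3 → ℝ} (hψ : ContDiff ℝ 2 ψ)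
    (hψs : HasCompactSupport ψ) :
    ∃ (A : ℝ) (h : ℝ → ℝ), 0 ≤ A ∧ (∀ r, h r ≤ A) ∧ Tendsto h atTop (nhds 0) ∧
      ∀ q : (E3 × E3) × E3,
        |collisionKernel I J Q c γ ψ q| ≤ h ‖q.1.2 - q.2‖ * ‖q.1.2 - q.2‖ ^ (1 + γ) := by
  obtain ⟨L, hL⟩ := hψ.lipschitzWith_of_hasCompactSupport hψs two_ne_zero
  obtain ⟨B, hB⟩ := hψs.exists_bound_of_continuous hψ.continuous
  have hB0 : 0 ≤ B := (norm_nonneg _).trans (hB 0)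
  have hθ : ∀ᵐ θ ∂Q.restrict (Set.Ioc 0 π), 0 < θ :=
    (ae_restrict_iff' measurableSet_Ioc).2 (Eventually.of_forall fun θ h => h.1)
  have hint : Integrable (fun θ : ℝ => θ) (Q.restrict (Set.Ioc 0 π)) := by
    refine ⟨by fun_prop, ?_⟩
    rw [hasFiniteIntegral_iff_ofReal (hθ.mono fun θ h => h.le)]
    exact lt_top_iff_ne_top.2 hQ
  set m : ℝ → ℝ → ℝ := fun r θ => 2 * π * min (2 * B / r) (2 * L * θ) with hm
  have hbint : Integrable (fun θ : ℝ => 2 * π * (2 * L * |θ|)) (Q.restrict (Set.Ioc 0 π)) :=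
    (hint.abs.const_mul _).const_mul _
  have hm_meas : ∀ r, Measurable (m r) := fun r => by simp only [hm]; fun_prop
  have hm_le : ∀ r θ, m r θ ≤ 2 * π * (2 * L * |θ|) := fun r θ => by
    simp only [hm]
    gcongr
    exact (min_le_right _ _).trans (by gcongr; exact le_abs_self θ)
  have hm_nonneg : ∀ r θ, 0 ≤ r → 0 ≤ θ → 0 ≤ m r θ := fun r θ hr hθ => by
    simp only [hm]
    positivity
  have hI0 : 0 ≤ ∫ θ in Set.Ioc 0 π, 2 * π * (2 * L * |θ|) ∂Q :=
    integral_nonneg fun θ => by positivity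
  have hm_int : ∀ r, 0 ≤ r → Integrable (m r) (Q.restrict (Set.Ioc 0 π)) := fun r hr => by
    refine hbint.mono' (hm_meas r).aestronglyMeasurable ?_
    filter_upwards [hθ] with θ h
    rw [Real.norm_of_nonneg (hm_nonneg r θ hr h.le)]
    exact hm_le r θ
  refine ⟨c * ∫ θ in Set.Ioc 0 π, 2 * π * (2 * L * |θ|) ∂Q,
    fun r => c * ∫ θ in Set.Ioc 0 π, m r θ ∂Q, by positivity, fun r => ?_, ?_, fun q => ?_⟩
  · refine mul_le_mul_of_nonneg_left ?_ hc.le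
    by_cases h : Integrable (m r) (Q.restrict (Set.Ioc 0 π))
    · exact integral_mono h hbint (hm_le r)
    · rwa [integral_undef h]
  · have : Tendsto (fun r => ∫ θ in Set.Ioc 0 π, m r θ ∂Q) atTop
        (nhds (∫ θ in Set.Ioc 0 π, (0 : ℝ) ∂Q)) := by
      refine tendsto_integral_filter_of_dominated_convergence _
        (Eventually.of_forall fun r => (hm_meas r).aestronglyMeasurable) ?_ hbint ?_
      · filter_upwards [eventually_ge_atTop 0] with r hr
        filter_upwards [hθ] with θ h
        rw [Real.norm_of_nonneg (hm_nonneg r θ hr h.le)]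
        exact hm_le r θ
      · filter_upwards [hθ] with θ h
        have h1 : Tendsto (fun r : ℝ => 2 * B / r) atTop (nhds 0) :=
          tendsto_const_nhds.div_atTop tendsto_id
        have h2 : Tendsto (fun r => 2 * π * (2 * B / r)) atTop (nhds 0) := by
          simpa using h1.const_mul (2 * π)
        refine tendsto_of_tendsto_of_tendsto_of_le_of_le' tendsto_const_nhds h2 ?_ ?_
        · filter_upwards [eventually_ge_atTop 0] with r hr using hm_nonneg r θ hr h.le
        · refine Eventually.of_forall fun r => ?_
          simp only [hm]
          gcongr
          exact min_le_left _ _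
    simpa using this.const_mul c
  · obtain ⟨⟨x, u⟩, v⟩ := q
    rcases eq_or_ne u v with rfl | huv
    · simp [collisionKernel, alpha, Gam, Real.zero_rpow hγ.ne']
    have hr : 0 < ‖u - v‖ := norm_pos_iff.2 (sub_ne_zero.2 huv)
    have key : |∫ θ in Set.Ioc 0 π, ∫ φ in Set.Ico 0 (2 * π),
        (ψ (x, u + alpha I J u v θ φ) - ψ (x, u)) ∂volume ∂Q| ≤
        ∫ θ in Set.Ioc 0 π, ‖u - v‖ * m ‖u - v‖ θ ∂Q := by
      rw [← Real.norm_eq_abs]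
      refine norm_integral_le_of_norm_le ((hm_int _ hr.le).const_mul _) ?_
      filter_upwards [hθ] with θ h
      have hpt : ∀ φ, ‖ψ (x, u + alpha I J u v θ φ) - ψ (x, u)‖ ≤
          ‖u - v‖ * min (2 * B / ‖u - v‖) (2 * L * θ) := fun φ => by
        rw [mul_min_of_nonneg _ _ hr.le, mul_div_cancel₀ _ hr.ne']
        refine le_min ?_ ?_
        · exact (norm_sub_le _ _).trans (by linarith [hB (x, u + alpha I J u v θ φ), hB (x, u)])
        · have h1 := hL.norm_sub_le (x, u + alpha I J u v θ φ) (x, u)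
          have h2 := norm_alpha_le hON u v h.le φ
          have h3 : ‖((x, u + alpha I J u v θ φ) : E3 × E3) - (x, u)‖ = ‖alpha I J u v θ φ‖ := by
            simp [Prod.norm_def]
          rw [h3] at h1
          calc _ ≤ L * ‖alpha I J u v θ φ‖ := h1
            _ ≤ L * (2 * θ * ‖u - v‖) := by gcongr
            _ = _ := by ring
      have := norm_setIntegral_le_of_norm_le_const (μ := volume) (s := Set.Ico 0 (2 * π))
        measure_Ico_lt_top (fun φ _ => hpt φ)
      refine this.trans_eq ?_
      rw [Real.volume_real_Ico_of_le Real.two_pi_pos.le]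
      simp only [hm]
      ring
    rw [integral_const_mul] at key
    simp only [collisionKernel]
    rw [abs_mul, abs_of_nonneg (by positivity : 0 ≤ c * ‖u - v‖ ^ γ), Real.rpow_add hr,
      Real.rpow_one]
    calc _ ≤ ‖u - v‖ * (∫ θ in Set.Ioc 0 π, m ‖u - v‖ θ ∂Q) * (c * ‖u - v‖ ^ γ) := by gcongr
      _ = _ := by ring

lemma norm_sub_rpow_le {a : ℝ} (ha : 0 ≤ a) (u v : E3) :
    ‖u - v‖ ^ a ≤ 2 ^ a * (‖u‖ ^ a + ‖v‖ ^ a) := by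
  have h1 : ‖u - v‖ ≤ 2 * max ‖u‖ ‖v‖ :=
    (norm_sub_le u v).trans (by linarith [le_max_left ‖u‖ ‖v‖, le_max_right ‖u‖ ‖v‖])
  calc ‖u - v‖ ^ a ≤ (2 * max ‖u‖ ‖v‖) ^ a := by gcongr
    _ = 2 ^ a * max ‖u‖ ‖v‖ ^ a :=
      Real.mul_rpow zero_le_two ((norm_nonneg u).trans (le_max_left _ _))
    _ ≤ _ := by
      gcongr
      rcases max_choice ‖u‖ ‖v‖ with h | h <;> rw [h]
      · linarith [Real.rpow_nonneg (norm_nonneg v) a]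
      · linarith [Real.rpow_nonneg (norm_nonneg u) a]

/-- Relative to the product weight `(1 + ‖u‖ ^ a) (1 + ‖v‖ ^ a)`, the bound of
`exists_collisionKernel_bound` vanishes at infinity. -/
lemma exists_radius_weight_bound {a A : ℝ} (ha : 0 < a) (hA : 0 ≤ A) {h : ℝ → ℝ}
    (hhA : ∀ r, h r ≤ A) (hh : Tendsto h atTop (nhds 0)) {ε : ℝ} (hε : 0 < ε) :
    ∃ n : ℝ, ∀ u v : E3, n < ‖u‖ ∨ n < ‖v‖ →
      h ‖u - v‖ * ‖u - v‖ ^ a ≤ ε * ((1 + ‖u‖ ^ a) * (1 + ‖v‖ ^ a)) := by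
  have h2a : (0 : ℝ) < 2 ^ a := by positivity
  obtain ⟨R, hR⟩ := eventually_atTop.1 (hh.eventually (gt_mem_nhds (div_pos hε h2a)))
  have hR0 : 0 ≤ max R 0 := le_max_right _ _
  obtain ⟨n, hn, hn0⟩ := (((tendsto_rpow_atTop ha).eventually_ge_atTop
    (A * max R 0 ^ a / ε)).and (eventually_ge_atTop 0)).exists
  refine ⟨n, fun u v huv => ?_⟩
  have hu := Real.rpow_nonneg (norm_nonneg u) a
  have hv := Real.rpow_nonneg (norm_nonneg v) a
  have hr := Real.rpow_nonneg (norm_nonneg (u - v)) a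
  have hW : ‖u‖ ^ a + ‖v‖ ^ a ≤ (1 + ‖u‖ ^ a) * (1 + ‖v‖ ^ a) := by nlinarith [mul_nonneg hu hv]
  rcases le_or_gt R ‖u - v‖ with hle | hlt
  · calc h ‖u - v‖ * ‖u - v‖ ^ a ≤ ε / 2 ^ a * ‖u - v‖ ^ a := by
          gcongr
          exact (hR _ hle).le
      _ ≤ ε / 2 ^ a * (2 ^ a * (‖u‖ ^ a + ‖v‖ ^ a)) := by gcongr; exact norm_sub_rpow_le ha.le u v
      _ = ε * (‖u‖ ^ a + ‖v‖ ^ a) := by field_simp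
      _ ≤ _ := by gcongr
  · have hna : n ^ a ≤ ‖u‖ ^ a + ‖v‖ ^ a := by
      rcases huv with h' | h'
      · have : n ^ a ≤ ‖u‖ ^ a := by gcongr
        linarith
      · have : n ^ a ≤ ‖v‖ ^ a := by gcongr
        linarith
    have hlt' : ‖u - v‖ ≤ max R 0 := hlt.le.trans (le_max_left _ _)
    calc h ‖u - v‖ * ‖u - v‖ ^ a ≤ A * max R 0 ^ a := by
          have := hhA ‖u - v‖
          gcongr
      _ ≤ ε * n ^ a := by rwa [div_le_iff₀' hε] at hn
      _ ≤ ε * (‖u‖ ^ a + ‖v‖ ^ a) := by gcongr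
      _ ≤ _ := by gcongr

lemma lintegral_weight_le {a Cg M : ℝ} {g : E3 → ℝ} (hg0 : ∀ z, 0 ≤ g z)
    (hC : ∀ z ∈ Metric.closedBall (0 : E3) 1, g z ≤ Cg) (ha : 0 ≤ a)
    (hint : Integrable (fun z : E3 => ‖z‖ ^ a * g z)) (hM : ∫ z : E3, ‖z‖ ^ a * g z ≤ M) :
    ∫⁻ z : E3, ENNReal.ofReal ((1 + ‖z‖ ^ a) * g z) ≤
      ENNReal.ofReal 2 * ENNReal.ofReal M + ENNReal.ofReal Cg * volume (Metric.closedBall (0 : E3) 1) := by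
  have hpt : ∀ z : E3, ENNReal.ofReal ((1 + ‖z‖ ^ a) * g z) ≤
      ENNReal.ofReal 2 * ENNReal.ofReal (‖z‖ ^ a * g z) +
        (Metric.closedBall (0 : E3) 1).indicator (fun _ => ENNReal.ofReal Cg) z := fun z => by
    have hz : 0 ≤ ‖z‖ ^ a * g z := mul_nonneg (Real.rpow_nonneg (norm_nonneg z) a) (hg0 z)
    rw [← ENNReal.ofReal_mul zero_le_two]
    by_cases h : z ∈ Metric.closedBall (0 : E3) 1
    · rw [Set.indicator_of_mem h, ← ENNReal.ofReal_add (by positivity) ((hg0 z).trans (hC z h))]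
      exact ENNReal.ofReal_le_ofReal (by linarith [hC z h])
    · rw [Set.indicator_of_notMem h, add_zero]
      refine ENNReal.ofReal_le_ofReal ?_
      have h1 : 1 ≤ ‖z‖ ^ a := Real.one_le_rpow (by simpa using (not_le.1 (by simpa using h)).le) ha
      nlinarith [hg0 z]
  refine (lintegral_mono hpt).trans ?_
  rw [lintegral_add_right _ (measurable_const.indicator measurableSet_closedBall),
    lintegral_const_mul' _ _ ENNReal.ofReal_ne_top, lintegral_indicator measurableSet_closedBall,
    setLIntegral_const, ← ofReal_integral_eq_lintegral_ofReal hint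
      (Eventually.of_forall fun z => mul_nonneg (Real.rpow_nonneg (norm_nonneg z) a) (hg0 z))]
  gcongr

lemma measurable_indicator_mul_mul {S : Set E3} (hS : MeasurableSet S)
    {w : E3 → E3 → ENNReal} (hw : Measurable (fun p : E3 × E3 => w p.1 p.2)) :
    Measurable (fun q : (E3 × E3) × E3 =>
      S.indicator 1 q.1.1 * w q.1.1 q.1.2 * w q.1.1 q.2) :=
  (((measurable_one.indicator hS).comp (measurable_fst.comp measurable_fst)).mul
    (hw.comp measurable_fst)).mul
    (hw.comp (by fun_prop : Measurable fun q : (E3 × E3) × E3 => (q.1.1, q.2)))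

lemma lintegral_indicator_mul_mul_le {S : Set E3} (hS : MeasurableSet S)
    {w : E3 → E3 → ENNReal} (hw : Measurable (fun p : E3 × E3 => w p.1 p.2)) {N : ENNReal}
    (hN : ∀ x ∈ S, ∫⁻ z, w x z ≤ N) :
    ∫⁻ q : (E3 × E3) × E3, S.indicator 1 q.1.1 * w q.1.1 q.1.2 * w q.1.1 q.2 ≤
      N * N * volume S := by
  have hwx : ∀ x, Measurable (w x) := fun x => hw.comp measurable_prodMk_left
  have hH := measurable_indicator_mul_mul hS hw
  calc _ = ∫⁻ x, ∫⁻ u, ∫⁻ v, S.indicator 1 x * w x u * w x v := by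
        rw [Measure.volume_eq_prod, lintegral_prod _ hH.aemeasurable,
          Measure.volume_eq_prod, lintegral_prod _ hH.lintegral_prod_right'.aemeasurable]
    _ ≤ ∫⁻ x, S.indicator (fun _ => N * N) x := by
        refine lintegral_mono fun x => ?_
        by_cases hx : x ∈ S
        · simp only [Set.indicator_of_mem hx, Pi.one_apply, one_mul]
          simp_rw [lintegral_const_mul _ (hwx x)]
          rw [lintegral_mul_const _ (hwx x)]
          exact mul_le_mul' (hN x hx) (hN x hx)
        · simp [Set.indicator_of_notMem hx]
    _ = N * N * volume S := by
        rw [lintegral_indicator hS, setLIntegral_const]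

/-- A kernel dominated as in `exists_collisionKernel_bound`, paired with two copies of a continuous
density of uniformly bounded moment, depends continuously on time. -/
lemma continuousOn_integral_kernel {a A T M : ℝ} (ha : 0 < a) (hA : 0 ≤ A) {h : ℝ → ℝ}
    (hhA : ∀ r, h r ≤ A) (hh : Tendsto h atTop (nhds 0)) {S : Set E3} (hS : IsCompact S)
    {K : (E3 × E3) × E3 → ℝ} (hK : Measurable K) (hKS : ∀ q, q.1.1 ∉ S → K q = 0)
    (hKh : ∀ q, |K q| ≤ h ‖q.1.2 - q.2‖ * ‖q.1.2 - q.2‖ ^ a)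
    {f : ℝ → E3 → E3 → ℝ} (hf0 : ∀ t x u, 0 ≤ f t x u)
    (hf : Continuous (fun p : ℝ × E3 × E3 => f p.1 p.2.1 p.2.2))
    (hint : ∀ s ∈ Set.Icc 0 T, ∀ x : E3, Integrable (fun z : E3 => ‖z‖ ^ a * f s x z))
    (hM : ∀ s ∈ Set.Icc 0 T, ∀ x : E3, ∫ z : E3, ‖z‖ ^ a * f s x z ≤ M) :
    ContinuousOn (fun s => ∫ p : E3 × E3, ∫ v : E3, K (p, v) * f s p.1 v * f s p.1 p.2)
      (Set.Icc 0 T) := by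
  set W : E3 → ℝ := fun z => 1 + ‖z‖ ^ a with hW
  have hW0 : ∀ z, 0 ≤ W z := fun z => by simp only [hW]; positivity
  have hWm : Continuous W := continuous_const.add (continuous_norm.rpow_const fun _ => Or.inr ha.le)
  have hfb : ∀ n : ℝ, ∃ C, ∀ s ∈ Set.Icc 0 T, ∀ x ∈ S, ∀ z ∈ Metric.closedBall (0 : E3) n,
      f s x z ≤ C := fun n => by
    obtain ⟨C, hC⟩ := (isCompact_Icc.prod (hS.prod
      (isCompact_closedBall (0 : E3) n))).exists_bound_of_continuousOn hf.continuousOn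
    exact ⟨C, fun s hs x hx z hz => (le_abs_self _).trans (hC (s, x, z) ⟨hs, hx, hz⟩)⟩
  set Φ : ℝ → (E3 × E3) × E3 → ℝ := fun s q => K q * f s q.1.1 q.2 * f s q.1.1 q.1.2 with hΦ
  have hΦm : ∀ s, Measurable (Φ s) := fun s => by
    have h1 : Measurable (fun q : (E3 × E3) × E3 => f s q.1.1 q.2) :=
      (hf.comp (by fun_prop : Continuous fun q : (E3 × E3) × E3 => (s, q.1.1, q.2))).measurable
    have h2 : Measurable (fun q : (E3 × E3) × E3 => f s q.1.1 q.1.2) :=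
      (hf.comp (by fun_prop : Continuous fun q : (E3 × E3) × E3 => (s, q.1.1, q.1.2))).measurable
    exact (hK.mul h1).mul h2
  set w : ℝ → E3 → E3 → ENNReal := fun s x z => ENNReal.ofReal (W z * f s x z) with hw
  have hwm : ∀ s, Measurable (fun p : E3 × E3 => w s p.1 p.2) := fun s => by
    have h1 : Continuous (fun p : E3 × E3 => f s p.1 p.2) :=
      hf.comp (by fun_prop : Continuous fun p : E3 × E3 => (s, p))
    exact ((hWm.comp continuous_snd).mul h1).measurable.ennreal_ofReal
  set H : ℝ → (E3 × E3) × E3 → ENNReal :=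
    fun s q => S.indicator 1 q.1.1 * w s q.1.1 q.1.2 * w s q.1.1 q.2 with hH
  have hHm : ∀ s, Measurable (H s) := fun s =>
    measurable_indicator_mul_mul hS.isClosed.measurableSet (hwm s)
  obtain ⟨V, hV⟩ : ∃ V : NNReal, ∀ s ∈ Set.Icc 0 T, ∫⁻ q, H s q ≤ V := by
    obtain ⟨C, hC⟩ := hfb 1
    set N : ENNReal :=
      ENNReal.ofReal 2 * ENNReal.ofReal M + ENNReal.ofReal C * volume (Metric.closedBall (0 : E3) 1) with hN
    have hNtop : N ≠ ⊤ := by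
      have := (measure_closedBall_lt_top (μ := volume) (x := (0 : E3)) (r := 1)).ne
      finiteness
    have hVtop : N * N * volume S ≠ ⊤ := by
      have := hS.measure_lt_top (μ := volume).ne
      finiteness
    refine ⟨(N * N * volume S).toNNReal, fun s hs => ?_⟩
    rw [ENNReal.coe_toNNReal hVtop]
    have hwN : ∀ x ∈ S, ∫⁻ z, w s x z ≤ N := fun x hx =>
      lintegral_weight_le (hf0 s x) (hC s hs x hx) ha.le (hint s hs x) (hM s hs x)
    exact lintegral_indicator_mul_mul_le hS.isClosed.measurableSet (hwm s) hwN
  have hΦH : ∀ s q (ε : ℝ), 0 ≤ ε → |K q| ≤ ε * (W q.1.2 * W q.2) →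
      ‖Φ s q‖ₑ ≤ ENNReal.ofReal ε * H s q := fun s q ε hε hq => by
    by_cases hx : q.1.1 ∈ S
    · simp only [hH, hw, hΦ, Set.indicator_of_mem hx, Pi.one_apply, one_mul]
      rw [← ENNReal.ofReal_mul (mul_nonneg (hW0 _) (hf0 _ _ _)), ← ENNReal.ofReal_mul hε,
        Real.enorm_eq_ofReal_abs]
      refine ENNReal.ofReal_le_ofReal ?_
      rw [abs_mul, abs_mul, abs_of_nonneg (hf0 s q.1.1 q.2), abs_of_nonneg (hf0 s q.1.1 q.1.2)]
      have h1 := hf0 s q.1.1 q.2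
      have h2 := hf0 s q.1.1 q.1.2
      calc _ ≤ ε * (W q.1.2 * W q.2) * f s q.1.1 q.2 * f s q.1.1 q.1.2 := by gcongr
        _ = _ := by ring
    · simp [hΦ, hKS q hx]
  have hKW : ∀ q, |K q| ≤ A * 2 ^ a * (W q.1.2 * W q.2) := fun q => by
    have hu := Real.rpow_nonneg (norm_nonneg q.1.2) a
    have hv := Real.rpow_nonneg (norm_nonneg q.2) a
    have := hhA ‖q.1.2 - q.2‖
    calc |K q| ≤ h ‖q.1.2 - q.2‖ * ‖q.1.2 - q.2‖ ^ a := hKh q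
      _ ≤ A * (2 ^ a * (‖q.1.2‖ ^ a + ‖q.2‖ ^ a)) := by
        gcongr
        exact norm_sub_rpow_le ha.le _ _
      _ ≤ A * (2 ^ a * (W q.1.2 * W q.2)) := by
        gcongr
        simp only [hW]
        nlinarith [mul_nonneg hu hv]
      _ = _ := by ring
  have hΦi : ∀ s ∈ Set.Icc 0 T, Integrable (Φ s) := fun s hs => by
    refine ⟨(hΦm s).aestronglyMeasurable, ?_⟩
    have hA' : 0 ≤ A * 2 ^ a := by positivity
    calc ∫⁻ q, ‖Φ s q‖ₑ ≤ ∫⁻ q, ENNReal.ofReal (A * 2 ^ a) * H s q :=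
          lintegral_mono fun q => hΦH s q _ hA' (hKW q)
      _ = ENNReal.ofReal (A * 2 ^ a) * ∫⁻ q, H s q := lintegral_const_mul _ (hHm s)
      _ ≤ ENNReal.ofReal (A * 2 ^ a) * V := by gcongr; exact hV s hs
      _ < ⊤ := by finiteness
  suffices hc : ContinuousOn (fun s => ∫ q, Φ s q) (Set.Icc 0 T) by
    refine hc.congr fun s hs => ?_
    have := hΦi s hs
    rw [Measure.volume_eq_prod] at this
    exact (integral_prod _ this).symm
  refine continuousOn_of_uniform_approx_of_continuousOn fun U hU => ?_
  obtain ⟨δ, hδ, hδU⟩ := Metric.mem_uniformity_dist.1 hU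
  have hV1 : (0 : ℝ) < V + 1 := by positivity
  obtain ⟨n, hn⟩ := exists_radius_weight_bound ha hA hhA hh (div_pos hδ hV1)
  set D : Set ((E3 × E3) × E3) :=
    (S ×ˢ Metric.closedBall 0 n) ×ˢ Metric.closedBall 0 n with hD
  have hDc : IsCompact D :=
    (hS.prod (isCompact_closedBall 0 n)).prod (isCompact_closedBall 0 n)
  have hDm : MeasurableSet D := hDc.isClosed.measurableSet
  refine ⟨fun s => ∫ q in D, Φ s q, ?_, fun s hs => hδU ?_⟩
  · obtain ⟨C, hC⟩ := hfb n
    obtain ⟨B, hB⟩ := hDc.exists_bound_of_continuousOn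
      (f := fun q : (E3 × E3) × E3 => A * 2 ^ a * (W q.1.2 * W q.2)) (by fun_prop)
    have : IsFiniteMeasure (volume.restrict D) := ⟨by simpa using hDc.measure_lt_top⟩
    refine continuousOn_of_dominated (bound := fun _ => B * C * C)
      (fun s _ => (hΦm s).aestronglyMeasurable) (fun s hs => ?_) (integrable_const _) ?_
    · refine (ae_restrict_iff' hDm).2 (Eventually.of_forall fun q hq => ?_)
      have h1 := hC s hs _ hq.1.1 _ hq.2
      have h2 := hC s hs _ hq.1.1 _ hq.1.2
      have h3 : |K q| ≤ B := (hKW q).trans ((le_abs_self _).trans (hB q hq))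
      have h4 := hf0 s q.1.1 q.2
      have h5 := hf0 s q.1.1 q.1.2
      simp only [hΦ, norm_mul, Real.norm_eq_abs, abs_of_nonneg h4, abs_of_nonneg h5]
      have h6 := (abs_nonneg _).trans h3
      have h7 := h4.trans h1
      gcongr
    · refine Eventually.of_forall fun q => Continuous.continuousOn ?_
      have h1 : Continuous (fun s => f s q.1.1 q.2) :=
        hf.comp (by fun_prop : Continuous fun s : ℝ => (s, q.1.1, q.2))
      have h2 : Continuous (fun s => f s q.1.1 q.1.2) :=
        hf.comp (by fun_prop : Continuous fun s : ℝ => (s, q.1.1, q.1.2))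
      exact (continuous_const.mul h1).mul h2
  · rw [dist_eq_norm, ← setIntegral_compl hDm (hΦi s hs)]
    set ε : ℝ := δ / (V + 1)
    have hε : 0 ≤ ε := (div_pos hδ hV1).le
    have hle : ‖∫ q in Dᶜ, Φ s q‖ₑ ≤ ENNReal.ofReal (ε * V) := by
      calc ‖∫ q in Dᶜ, Φ s q‖ₑ ≤ ∫⁻ q in Dᶜ, ‖Φ s q‖ₑ := enorm_integral_le_lintegral_enorm _
        _ ≤ ∫⁻ q in Dᶜ, ENNReal.ofReal ε * H s q := by
          refine setLIntegral_mono ((hHm s).const_mul _) fun q hq => ?_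
          by_cases hx : q.1.1 ∈ S
          · refine hΦH s q ε hε ((hKh q).trans (hn _ _ ?_))
            by_contra! hcon
            exact hq ⟨⟨hx, by simpa using hcon.1⟩, by simpa using hcon.2⟩
          · simp [hΦ, hKS q hx]
        _ ≤ ∫⁻ q, ENNReal.ofReal ε * H s q := setLIntegral_le_lintegral _ _
        _ = ENNReal.ofReal ε * ∫⁻ q, H s q := lintegral_const_mul _ (hHm s)
        _ ≤ ENNReal.ofReal ε * V := by gcongr; exact hV s hs
        _ = ENNReal.ofReal (ε * V) := by
          rw [ENNReal.ofReal_mul hε, ENNReal.ofReal_coe_nnreal]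
    rw [← ofReal_norm, ENNReal.ofReal_le_ofReal_iff (by positivity)] at hle
    refine hle.trans_lt ?_
    calc ε * V < ε * (V + 1) := by
          have : 0 < ε := div_pos hδ hV1
          gcongr
          linarith
      _ = δ := div_mul_cancel₀ _ hV1.ne'

/-- Under Hypotheses A1, A2 and B1–B3, the collision pairing
`g(s) = ∫∫∫∫∫ [ψ(x,u+α)−ψ(x,u)] σ(‖u−v‖) f(s,x,v) f(s,x,u) dφ Q(dθ) dv dx du`
is continuous on `[0,T]`. -/
theorem stmt_15
    (I J : E3 → E3) (hI : Measurable I) (hJ : Measurable J)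
    (hON : ∀ X : E3, X ≠ 0 →
      Orthonormal ℝ ![‖X‖⁻¹ • X, ‖X‖⁻¹ • I X, ‖X‖⁻¹ • J X])
    (Q : Measure ℝ) [SigmaFinite Q]
    (hQ : ∫⁻ θ in Set.Ioc 0 π, ENNReal.ofReal θ ∂Q ≠ ⊤)
    (c γ : ℝ) (hc : 0 < c) (hγ : γ ∈ Set.Ioc (-1 : ℝ) 1)
    (T : ℝ) (hT : 0 < T)
    (f ft : ℝ → E3 → E3 → ℝ)
    (hf0 : ∀ t x u, 0 ≤ f t x u)
    (hf_cont : Continuous (fun p : ℝ × E3 × E3 => f p.1 p.2.1 p.2.2))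
    (hft : ∀ t x u, HasDerivAt (fun s => f s x u) (ft t x u) t)
    -- B1
    (hB1 : ∀ t ∈ Set.Icc 0 T, Integrable (fun p : E3 × E3 => ft t p.1 p.2))
    -- B2
    (hB2_int : ∀ s ∈ Set.Icc 0 T, ∀ x : E3,
      Integrable (fun z : E3 => ‖z‖ ^ (1 + γ) * f s x z))
    (hB2_bdd : ∀ s ∈ Set.Icc 0 T,
      BddAbove (Set.range fun x : E3 => ∫ z : E3, ‖z‖ ^ (1 + γ) * f s x z))
    (hB2 : ContinuousOn
      (fun s => ⨆ x : E3, ∫ z : E3, ‖z‖ ^ (1 + γ) * f s x z) (Set.Icc 0 T))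
    -- B3
    (hB3_int : ∀ t ∈ Set.Icc 0 T, ∀ x : E3,
      Integrable (fun z : E3 => ‖z‖ ^ (1 + γ) * |ft t x z|))
    (hB3 : IntegrableOn
      (fun t => ⨆ x : E3, ∫ z : E3, ‖z‖ ^ (1 + γ) * |ft t x z|) (Set.Icc 0 T))
    (ψ : E3 × E3 → ℝ) (hψ : ContDiff ℝ 2 ψ) (hψs : HasCompactSupport ψ) :
    ContinuousOn
      (fun s => ∫ p : E3 × E3,
        ∫ v : E3, ∫ θ in Set.Ioc 0 π, ∫ φ in Set.Ico 0 (2 * π),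
          (ψ (p.1, p.2 + alpha I J p.2 v θ φ) - ψ p) * (c * ‖p.2 - v‖ ^ γ)
            * f s p.1 v * f s p.1 p.2
          ∂volume ∂Q ∂volume)
      (Set.Icc 0 T) := by
  have hγ' : 0 < 1 + γ := by linarith [hγ.1]
  obtain ⟨A, h, hA, hhA, hh, hKh⟩ := exists_collisionKernel_bound hON hQ hc hγ' hψ hψs
  obtain ⟨M, hM⟩ := isCompact_Icc.bddAbove_image hB2
  have hmom : ∀ s ∈ Set.Icc 0 T, ∀ x : E3, ∫ z : E3, ‖z‖ ^ (1 + γ) * f s x z ≤ M :=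
    fun s hs x => (le_ciSup (hB2_bdd s hs) x).trans (hM ⟨s, hs, rfl⟩)
  have key := continuousOn_integral_kernel hγ' hA hhA hh (hψs.isCompact.image continuous_fst)
    (measurable_collisionKernel hI hJ Q c γ hψ.continuous.measurable)
    (fun _ => collisionKernel_eq_zero) hKh hf0 hf_cont hB2_int hmom
  refine key.congr fun s _ => ?_
  simp only [collisionKernel, integral_mul_const]
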